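/- Let ξ(s,t) = (s, −t/2) and γ(s,t) = s/√(1−s²) for −1 < s < 1 and 0 ≤ t < T. Then (γ,ξ) is a weak solution of the Birkhoff-Rott equations with initial data ξ₀(s) = (s,0), γ₀(s) = s/√(1−s²): γ ∈ L^∞((0,T); L¹(ds)), U[ξ;γ](s,t) = (0,−1/2) for all −1 < s < 1 (so γ·U[ξ;γ] ∈ L^∞((0,T); L¹(ds))), and for every test function φ ∈ C_c^∞([0,T)×ℝ²): ∫₀^T ∫_{−1}^{1} γ(s,t){φ_t(ξ(s,t),t) + (0,−1/2)·∇φ(ξ(s,t),t)} ds dt + ∫_{−1}^{1} γ₀(s) φ(ξ₀(s),0) ds = 0. -/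

import Mathlib

/-!
STATEMENT 13: the translating Prandtl-Munk sheet ξ(s,t) = (s,−t/2), γ(s,t) = s/√(1−s²)
is a weak solution of the Birkhoff-Rott equations with initial data ξ₀(s) = (s,0),
γ₀(s) = s/√(1−s²), the Birkhoff-Rott velocity being the constant (0,−1/2). -/

open MeasureTheory Real Filter Set Function
open scoped Topology

noncomputable section

abbrev R2 : Type := EuclideanSpace ℝ (Fin 2)

def perp (x : R2) : R2 := (WithLp.equiv 2 (Fin 2 → ℝ)).symm ![-(x 1), x 0]

def K (x : R2) : R2 := (2 * π * ‖x‖ ^ 2)⁻¹ • perp x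

/-- The Birkhoff-Rott principal-value velocity. -/
def HasBRVelocity (s0 s1 : ℝ) (ξ : ℝ → R2) (γ : ℝ → ℝ) (s : ℝ) (v : R2) : Prop :=
  Tendsto (fun ε : ℝ => ∫ r in {r | r ∈ Icc s0 s1 ∧ ε ≤ ‖ξ s - ξ r‖}, γ r • K (ξ s - ξ r))
    (𝓝[>] 0) (𝓝 v)

/-- Test functions φ ∈ C_c^∞([0,T) × ℝ²). -/
def IsTest (T : ℝ) (φ : ℝ → R2 → ℝ) : Prop :=
  ContDiff ℝ (⊤ : ℕ∞) ↿φ ∧ HasCompactSupport ↿φ ∧ tsupport ↿φ ⊆ Iio T ×ˢ univ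

/-- The Prandtl-Munk sheet at time t: ξ(s,t) = (s, −t/2). -/
def xiPM (s t : ℝ) : R2 := (WithLp.equiv 2 (Fin 2 → ℝ)).symm ![s, -(t / 2)]

/-- The Prandtl-Munk vorticity density γ(s,t) = γ₀(s) = s/√(1−s²). -/
def gammaPM (s : ℝ) : ℝ := s / Real.sqrt (1 - s ^ 2)

/-- The constant velocity (0, −1/2). -/
def vPM : R2 := (WithLp.equiv 2 (Fin 2 → ℝ)).symm ![0, -(1/2 : ℝ)]

/-- The density of the arcsine law is integrable. -/
lemma integrableOn_inv_sqrt_one_sub_sq :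
    IntegrableOn (fun r : ℝ => 1 / √(1 - r ^ 2)) (Icc (-1) 1) := by
  have h := intervalIntegral.intervalIntegrable_deriv_of_nonneg (a := -1) (b := 1)
    (g := arcsin) (g' := fun r : ℝ => 1 / √(1 - r ^ 2)) continuous_arcsin.continuousOn
    (fun x hx => by
      rw [min_eq_left (by norm_num), max_eq_right (by norm_num)] at hx
      exact hasDerivAt_arcsin hx.1.ne' hx.2.ne)
    (fun x _ => by positivity)
  rwa [intervalIntegrable_iff_integrableOn_Icc_of_le (by norm_num)] at h

lemma measurable_gammaPM : Measurable gammaPM := by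
  unfold gammaPM; fun_prop

lemma integrableOn_gammaPM : IntegrableOn gammaPM (Icc (-1) 1) := by
  refine Integrable.mono' integrableOn_inv_sqrt_one_sub_sq
    measurable_gammaPM.aestronglyMeasurable ?_
  filter_upwards [ae_restrict_mem measurableSet_Icc] with r hr
  rw [gammaPM, norm_eq_abs, abs_div, abs_of_nonneg (sqrt_nonneg _)]
  gcongr
  exact abs_le.2 hr

/-- The unit vector `(0, 1)`. -/
def verticalUnit : R2 := (WithLp.equiv 2 (Fin 2 → ℝ)).symm ![0, 1]

lemma vPM_eq_smul : vPM = (-(1 / 2) : ℝ) • verticalUnit := by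
  ext i; fin_cases i <;> simp [vPM, verticalUnit]

lemma norm_xiPM_sub (s r t : ℝ) : ‖xiPM s t - xiPM r t‖ = |s - r| := by
  simp [EuclideanSpace.norm_eq, Fin.sum_univ_two, xiPM, sqrt_sq_eq_abs]

lemma K_xiPM_sub (s r t : ℝ) :
    K (xiPM s t - xiPM r t) = (2 * π * (s - r))⁻¹ • verticalUnit := by
  have hp : perp (xiPM s t - xiPM r t) = (s - r) • verticalUnit := by
    ext i; fin_cases i <;> simp [perp, xiPM, verticalUnit]
  rw [K, norm_xiPM_sub, sq_abs, hp, smul_smul]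
  congr 1
  rcases eq_or_ne (s - r) 0 with h | h
  · simp [h]
  · field_simp

/-- The numerator in the logarithmic primitive of the finite Hilbert kernel. -/
def sheetNum (s r : ℝ) : ℝ := 1 - s * r + √(1 - s ^ 2) * √(1 - r ^ 2)

/-- A primitive of `r ↦ γ(r) / (2π (s - r))`. -/
def sheetPrimitive (s r : ℝ) : ℝ :=
  (2 * π)⁻¹ * (s / √(1 - s ^ 2) * (log (sheetNum s r) - log (s - r)) - arcsin r)

lemma continuous_sheetNum (s : ℝ) : Continuous (sheetNum s) := by
  unfold sheetNum; fun_prop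

lemma sheetNum_pos {s r : ℝ} (hs : s ∈ Ioo (-1 : ℝ) 1) (hr : r ∈ Icc (-1 : ℝ) 1) :
    0 < sheetNum s r := by
  have h : s * r < 1 := by
    nlinarith [mul_nonneg (by linarith [hs.1] : 0 ≤ 1 + s) (by linarith [hr.2] : 0 ≤ 1 - r),
      mul_nonneg (by linarith [hs.2] : 0 ≤ 1 - s) (by linarith [hr.1] : 0 ≤ 1 + r),
      hs.1, hs.2, hr.1, hr.2]
  have : 0 ≤ √(1 - s ^ 2) * √(1 - r ^ 2) := by positivity
  unfold sheetNum; linarith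

lemma one_sub_sq_pos {s : ℝ} (hs : s ∈ Ioo (-1 : ℝ) 1) : 0 < 1 - s ^ 2 := by
  nlinarith [hs.1, hs.2]

lemma continuousOn_sheetPrimitive {s : ℝ} (hs : s ∈ Ioo (-1 : ℝ) 1) :
    ContinuousOn (sheetPrimitive s) (Icc (-1) 1 \ {s}) := by
  unfold sheetPrimitive
  refine continuousOn_const.mul ((continuousOn_const.mul (ContinuousOn.sub ?_ ?_)).sub
    continuous_arcsin.continuousOn)
  · exact (continuous_sheetNum s).continuousOn.log fun r hr => (sheetNum_pos hs hr.1).ne'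
  · exact ContinuousOn.log (by fun_prop) fun r hr => sub_ne_zero.2 fun h => hr.2 h.symm

lemma hasDerivAt_sheetPrimitive {s r : ℝ} (hs : s ∈ Ioo (-1 : ℝ) 1)
    (hr : r ∈ Ioo (-1 : ℝ) 1) (hrs : r ≠ s) :
    HasDerivAt (sheetPrimitive s) (gammaPM r * (2 * π * (s - r))⁻¹) r := by
  have ha2 := sq_sqrt (one_sub_sq_pos hs).le
  have hb2 := sq_sqrt (one_sub_sq_pos hr).le
  have ha : 0 < √(1 - s ^ 2) := sqrt_pos.2 (one_sub_sq_pos hs)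
  have hb : 0 < √(1 - r ^ 2) := sqrt_pos.2 (one_sub_sq_pos hr)
  have hN := sheetNum_pos hs ⟨hr.1.le, hr.2.le⟩
  have hsr : s - r ≠ 0 := sub_ne_zero.2 hrs.symm
  have h1 : HasDerivAt (fun r : ℝ => √(1 - r ^ 2)) (-r / √(1 - r ^ 2)) r := by
    have := (((hasDerivAt_id r).pow 2).const_sub 1).sqrt (one_sub_sq_pos hr).ne'
    refine this.congr_deriv ?_
    simp only [Pi.pow_apply, id]
    field_simp
    simp
  have h2 : HasDerivAt (sheetNum s) (-s + √(1 - s ^ 2) * (-r / √(1 - r ^ 2))) r := by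
    have := (((hasDerivAt_id r).const_mul s).const_sub 1).add (h1.const_mul √(1 - s ^ 2))
    exact this.congr_deriv (by simp)
  have h3 := h2.log hN.ne'
  have h4 := ((hasDerivAt_id r).const_sub s).log hsr
  have h5 := (((h3.sub h4).const_mul (s / √(1 - s ^ 2))).sub
    (hasDerivAt_arcsin hr.1.ne' hr.2.ne)).const_mul (2 * π)⁻¹
  refine h5.congr_deriv ?_
  have key : (-s + √(1 - s ^ 2) * (-r / √(1 - r ^ 2))) / sheetNum s r - -1 / (s - r)
      = √(1 - s ^ 2) / (√(1 - r ^ 2) * (s - r)) := by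
    rw [div_sub_div _ _ hN.ne' hsr, div_eq_div_iff (by positivity) (by positivity)]
    unfold sheetNum
    generalize √(1 - s ^ 2) = a at *
    generalize √(1 - r ^ 2) = b at *
    field_simp
    linear_combination -b * ha2 + a * hb2
  simp only [id] at key ⊢
  rw [key, gammaPM]
  field_simp
  ring

lemma sheetPrimitive_one {s : ℝ} : sheetPrimitive s 1 = -(1 / 4) := by
  have : log (sheetNum s 1) = log (s - 1) := by
    rw [← log_neg_eq_log (s - 1)]; simp [sheetNum]
  rw [sheetPrimitive, this, arcsin_one]
  field_simp
  ring

lemma sheetPrimitive_neg_one {s : ℝ} : sheetPrimitive s (-1) = 1 / 4 := by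
  have : log (sheetNum s (-1)) = log (s - -1) := by
    congr 1; simp [sheetNum, add_comm]
  rw [sheetPrimitive, this, arcsin_neg_one]
  field_simp
  ring

lemma integrableOn_gammaPM_mul_inv {s a b : ℝ} (hab : Icc a b ⊆ Icc (-1) 1 \ {s}) :
    IntegrableOn (fun r => gammaPM r * (2 * π * (s - r))⁻¹) (Icc a b) := by
  refine (integrableOn_gammaPM.mono_set (hab.trans sdiff_subset)).mul_continuousOn ?_
    isCompact_Icc
  refine ContinuousOn.inv₀ (by fun_prop) fun r hr => ?_
  have : s - r ≠ 0 := sub_ne_zero.2 fun h => (hab hr).2 h.symm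
  positivity

lemma integral_gammaPM_mul_inv {s a b : ℝ} (hs : s ∈ Ioo (-1 : ℝ) 1) (h : a ≤ b)
    (hab : Icc a b ⊆ Icc (-1) 1 \ {s}) :
    ∫ r in Icc a b, gammaPM r * (2 * π * (s - r))⁻¹
      = sheetPrimitive s b - sheetPrimitive s a := by
  rw [integral_Icc_eq_integral_Ioc, ← intervalIntegral.integral_of_le h]
  refine intervalIntegral.integral_eq_sub_of_hasDerivAt_of_le h
    ((continuousOn_sheetPrimitive hs).mono hab) (fun r hr => ?_)
    ((intervalIntegrable_iff_integrableOn_Icc_of_le h).2 (integrableOn_gammaPM_mul_inv hab))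
  have ha := (hab (left_mem_Icc.2 h)).1.1
  have hb := (hab (right_mem_Icc.2 h)).1.2
  exact hasDerivAt_sheetPrimitive hs ⟨ha.trans_lt hr.1, hr.2.trans_le hb⟩
    (hab (Ioo_subset_Icc_self hr)).2

/-- The truncated finite Hilbert transform of `γ` in closed form. -/
lemma integral_truncated_gammaPM {s ε : ℝ} (hs : s ∈ Ioo (-1 : ℝ) 1) (hε : 0 < ε)
    (h1 : -1 ≤ s - ε) (h2 : s + ε ≤ 1) :
    ∫ r in {r | r ∈ Icc (-1 : ℝ) 1 ∧ ε ≤ |s - r|}, gammaPM r * (2 * π * (s - r))⁻¹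
      = sheetPrimitive s (s - ε) - sheetPrimitive s (s + ε) - 1 / 2 := by
  have hset : {r | r ∈ Icc (-1 : ℝ) 1 ∧ ε ≤ |s - r|}
      = Icc (-1) (s - ε) ∪ Icc (s + ε) 1 := by
    ext r
    simp only [mem_ofPred_eq, mem_union, mem_Icc, le_abs]
    constructor
    · rintro ⟨⟨_, _⟩, h | h⟩
      · left; constructor <;> linarith
      · right; constructor <;> linarith
    · rintro (⟨_, _⟩ | ⟨_, _⟩)
      · exact ⟨⟨by linarith, by linarith⟩, Or.inl (by linarith)⟩
      · exact ⟨⟨by linarith, by linarith⟩, Or.inr (by linarith)⟩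
  have hl : Icc (-1) (s - ε) ⊆ Icc (-1 : ℝ) 1 \ {s} := fun r hr =>
    ⟨⟨hr.1, by linarith [hr.2]⟩, fun h => by
      rw [mem_singleton_iff] at h; linarith [hr.2]⟩
  have hr : Icc (s + ε) 1 ⊆ Icc (-1 : ℝ) 1 \ {s} := fun r hr =>
    ⟨⟨by linarith [hr.1], hr.2⟩, fun h => by
      rw [mem_singleton_iff] at h; linarith [hr.1]⟩
  have hd : Disjoint (Icc (-1) (s - ε)) (Icc (s + ε) 1) :=
    Set.disjoint_left.2 fun r hr hr' => by linarith [hr.2, hr'.1]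
  rw [hset, setIntegral_union hd measurableSet_Icc (integrableOn_gammaPM_mul_inv hl)
    (integrableOn_gammaPM_mul_inv hr), integral_gammaPM_mul_inv hs h1 hl,
    integral_gammaPM_mul_inv hs h2 hr, sheetPrimitive_one, sheetPrimitive_neg_one]
  ring

/-- The logarithmic singularities of the primitive cancel symmetrically. -/
lemma tendsto_sheetPrimitive_sub {s : ℝ} (hs : s ∈ Ioo (-1 : ℝ) 1) :
    Tendsto (fun ε => sheetPrimitive s (s - ε) - sheetPrimitive s (s + ε))
      (𝓝[>] 0) (𝓝 0) := by
  have hN := (sheetNum_pos hs ⟨hs.1.le, hs.2.le⟩).ne'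
  have hc : ContinuousAt (fun ε : ℝ => (2 * π)⁻¹ * (s / √(1 - s ^ 2) *
      (log (sheetNum s (s - ε)) - log (sheetNum s (s + ε)))
      - (arcsin (s - ε) - arcsin (s + ε)))) 0 := by
    have hcN := continuous_sheetNum s
    have e1 : ContinuousAt (fun ε : ℝ => log (sheetNum s (s - ε))) 0 :=
      ContinuousAt.log (by fun_prop) (by simpa using hN)
    have e2 : ContinuousAt (fun ε : ℝ => log (sheetNum s (s + ε))) 0 :=
      ContinuousAt.log (by fun_prop) (by simpa using hN)
    have e3 : Continuous (fun ε : ℝ => arcsin (s - ε) - arcsin (s + ε)) :=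
      (continuous_arcsin.comp (by fun_prop)).sub (continuous_arcsin.comp (by fun_prop))
    exact continuousAt_const.mul ((continuousAt_const.mul (e1.sub e2)).sub e3.continuousAt)
  have hlim := hc.tendsto
  simp only [sub_zero, add_zero, sub_self, mul_zero] at hlim
  refine (hlim.mono_left nhdsWithin_le_nhds).congr fun ε => ?_
  have hlog : log (s - (s - ε)) = log (s - (s + ε)) := by
    rw [← log_neg_eq_log (s - (s + ε))]; congr 1; ring
  rw [sheetPrimitive, sheetPrimitive, hlog]
  ring

lemma hasBRVelocity_xiPM {s : ℝ} (t : ℝ) (hs : s ∈ Ioo (-1 : ℝ) 1) :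
    HasBRVelocity (-1) 1 (fun r => xiPM r t) gammaPM s vPM := by
  have hlim : Tendsto (fun ε => (sheetPrimitive s (s - ε) - sheetPrimitive s (s + ε) - 1 / 2)
      • verticalUnit) (𝓝[>] 0) (𝓝 vPM) := by
    have := ((tendsto_sheetPrimitive_sub hs).sub_const (1 / 2)).smul_const verticalUnit
    rwa [zero_sub, ← vPM_eq_smul] at this
  refine hlim.congr' ?_
  have hm : 0 < min (1 - s) (1 + s) := lt_min (by linarith [hs.2]) (by linarith [hs.1])
  filter_upwards [Ioo_mem_nhdsGT hm] with ε hε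
  have hε' := lt_min_iff.1 hε.2
  simp only [norm_xiPM_sub, K_xiPM_sub, smul_smul]
  rw [integral_smul_const, integral_truncated_gammaPM hs hε.1 (by linarith) (by linarith)]

lemma xiPM_eq (s t : ℝ) : xiPM s t = xiPM s 0 + t • vPM := by
  ext i
  fin_cases i
  · simp [xiPM, vPM]
  · simp [xiPM, vPM]; ring

lemma continuous_xiPM : Continuous fun p : ℝ × ℝ => xiPM p.1 p.2 := by
  unfold xiPM
  refine (PiLp.continuous_toLp 2 _).comp (continuous_pi fun i => ?_)
  fin_cases i
  · exact continuous_fst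
  · exact (continuous_snd.div_const 2).neg

lemma hasDerivAt_xiPM (s t : ℝ) : HasDerivAt (xiPM s) vPM t := by
  have h : xiPM s = fun τ => xiPM s 0 + τ • vPM := funext (xiPM_eq s)
  rw [h]
  simpa using ((hasDerivAt_id t).smul_const vPM).const_add (xiPM s 0)

/-- The transport derivative of a test function along the sheet. -/
lemma deriv_add_fderiv_eq {φ : ℝ → R2 → ℝ} (hφ : Differentiable ℝ ↿φ) (t : ℝ) (x v : R2) :
    deriv (fun τ => φ τ x) t + fderiv ℝ (φ t) x v = fderiv ℝ ↿φ (t, x) (1, v) := by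
  have hL := (hφ (t, x)).hasFDerivAt
  have h1 : HasDerivAt (fun τ => φ τ x) (fderiv ℝ ↿φ (t, x) (1, 0)) t :=
    HasFDerivAt.comp_hasDerivAt (f := fun τ => (τ, x)) t hL ((hasDerivAt_id t).prodMk (hasDerivAt_const t x))
  have h2 : HasFDerivAt (φ t) ((fderiv ℝ ↿φ (t, x)).comp (ContinuousLinearMap.inr ℝ ℝ R2)) x :=
    hL.comp x (hasFDerivAt_prodMk_right t x)
  rw [h1.deriv, h2.fderiv, ContinuousLinearMap.comp_apply, ContinuousLinearMap.inr_apply,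
    ← map_add]
  simp

lemma integral_transport_derivative {φ : ℝ → R2 → ℝ} {T : ℝ} (hT : 0 < T)
    (hφ : IsTest T φ) (s : ℝ) :
    ∫ t in Ioo 0 T, fderiv ℝ ↿φ (t, xiPM s t) (1, vPM) = -φ 0 (xiPM s 0) := by
  obtain ⟨hs, -, hsupp⟩ := hφ
  have hd : Differentiable ℝ ↿φ := hs.differentiable (by simp)
  have hξ : Continuous (xiPM s) := continuous_xiPM.comp (by fun_prop : Continuous fun t => (s, t))
  have hc : Continuous fun t => fderiv ℝ ↿φ (t, xiPM s t) (1, vPM) :=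
    ((hs.continuous_fderiv (by simp)).comp (continuous_id.prodMk hξ)).clm_apply
      continuous_const
  have hderiv (t : ℝ) : HasDerivAt (fun τ => φ τ (xiPM s τ))
      (fderiv ℝ ↿φ (t, xiPM s t) (1, vPM)) t :=
    HasFDerivAt.comp_hasDerivAt (f := fun τ => (τ, xiPM s τ)) t (hd (t, xiPM s t)).hasFDerivAt
      ((hasDerivAt_id t).prodMk (hasDerivAt_xiPM s t))
  have hzero : φ T (xiPM s T) = 0 := by
    by_contra h
    exact lt_irrefl T (hsupp (subset_tsupport ↿φ (show (T, xiPM s T) ∈ support ↿φ from h))).1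
  rw [← integral_Ioc_eq_integral_Ioo, ← intervalIntegral.integral_of_le hT.le,
    intervalIntegral.integral_eq_sub_of_hasDerivAt (fun t _ => hderiv t)
      (hc.intervalIntegrable _ _), hzero, zero_sub]

lemma integrable_gammaPM_mul_transport {φ : ℝ → R2 → ℝ} {T : ℝ} (hφ : IsTest T φ) :
    Integrable (uncurry fun t s => gammaPM s * fderiv ℝ ↿φ (t, xiPM s t) (1, vPM))
      ((volume.restrict (Ioo 0 T)).prod (volume.restrict (Icc (-1) 1))) := by
  obtain ⟨hs, hcpt, -⟩ := hφ
  have hc : Continuous fun p => fderiv ℝ ↿φ p (1, vPM) :=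
    (hs.continuous_fderiv (by simp)).clm_apply continuous_const
  obtain ⟨C, hC⟩ := hc.bounded_above_of_compact_support
    (hcpt.fderiv_apply ℝ (1, vPM))
  have hg : Integrable (fun p : ℝ × ℝ => gammaPM p.2)
      ((volume.restrict (Ioo 0 T)).prod (volume.restrict (Icc (-1) 1))) :=
    Integrable.comp_snd integrableOn_gammaPM _
  have hcs : Continuous fun p : ℝ × ℝ => fderiv ℝ ↿φ (p.1, xiPM p.2 p.1) (1, vPM) :=
    hc.comp (continuous_fst.prodMk (continuous_xiPM.comp continuous_swap))
  exact hg.mul_bdd (c := C) hcs.aestronglyMeasurable (Eventually.of_forall fun p => hC _)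

/-- (γ(s,t),ξ(s,t)) = (s/√(1−s²), (s,−t/2)) is a weak solution of the
Birkhoff-Rott equations with initial data (γ₀,ξ₀) = (s/√(1−s²), (s,0)): γ ∈ L^∞(L¹),
U[ξ;γ] ≡ (0,−1/2) (so γ·U ∈ L^∞(L¹)), and the weak Birkhoff-Rott identity holds. -/
theorem prandtl_munk_is_weak_BR_solution (T : ℝ) (hT : 0 < T) :
    -- γ ∈ L^∞((0,T); L¹(ds))
    IntegrableOn gammaPM (Icc (-1 : ℝ) 1) ∧
    -- the Birkhoff-Rott velocity is (0,−1/2) for all −1 < s < 1 and all times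
    (∀ t ∈ Ico 0 T, ∀ s ∈ Ioo (-1 : ℝ) 1,
      HasBRVelocity (-1) 1 (fun r => xiPM r t) gammaPM s vPM) ∧
    -- γ·U[ξ;γ] ∈ L^∞((0,T); L¹(ds))
    IntegrableOn (fun s => gammaPM s • vPM) (Icc (-1 : ℝ) 1) ∧
    -- the weak Birkhoff-Rott identity
    (∀ φ : ℝ → R2 → ℝ, IsTest T φ →
      (∫ t in Ioo 0 T, ∫ s in Icc (-1 : ℝ) 1,
        gammaPM s * (deriv (fun τ => φ τ (xiPM s t)) t + fderiv ℝ (φ t) (xiPM s t) vPM))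
      + (∫ s in Icc (-1 : ℝ) 1, gammaPM s * φ 0 (xiPM s 0)) = 0) := by
  refine ⟨integrableOn_gammaPM, fun t _ s hs => hasBRVelocity_xiPM t hs,
    integrableOn_gammaPM.smul_const vPM, fun φ hφ => ?_⟩
  have hd : Differentiable ℝ ↿φ := hφ.1.differentiable (by simp)
  simp only [deriv_add_fderiv_eq hd]
  rw [integral_integral_swap (integrable_gammaPM_mul_transport hφ)]
  simp only [integral_const_mul, integral_transport_derivative hT hφ, mul_neg, integral_neg,
    neg_add_cancel]
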